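/- arXiv:2412.12540 — 2 statements merged into one kernel-verified Lean document; each statement's English description precedes it below -/
import Mathlib

section
/- Let n ≥ 1, let m ∈ ℝⁿ have strictly positive entries with total mass M = Σᵢ mᵢ, and let P_X, P_Y, P_Z be strictly positive reals. Let U be a real n×4 matrix with UᵀU = I₄ whose fourth column equals the unit mass vector, i.e., U_{i,4} = √(mᵢ/M) for all i. Define coordinates xᵢ = √(P_X/mᵢ)·U_{i,1}, yᵢ = √(P_Y/mᵢ)·U_{i,2}, zᵢ = √(P_Z/mᵢ)·U_{i,3}. Then these coordinates satisfy all nine constraints: Σᵢ mᵢxᵢ² = P_X, Σᵢ mᵢyᵢ² = P_Y, Σᵢ mᵢzᵢ² = P_Z, Σᵢ mᵢxᵢyᵢ = 0, Σᵢ mᵢxᵢzᵢ = 0, Σᵢ mᵢyᵢzᵢ = 0, Σᵢ mᵢxᵢ = 0, Σᵢ mᵢyᵢ = 0, Σᵢ mᵢzᵢ = 0. -/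
open Matrix Finset Real

theorem pair_aux {n : ℕ} (m : Fin n → ℝ) (hm : ∀ i, 0 < m i) (P Q : ℝ)
    (hP : 0 < P) (hQ : 0 < Q) (u v x y : Fin n → ℝ)
    (hx : ∀ i, x i = Real.sqrt (P / m i) * u i)
    (hy : ∀ i, y i = Real.sqrt (Q / m i) * v i) :
    ∑ i, m i * x i * y i = Real.sqrt P * Real.sqrt Q * ∑ i, u i * v i := by
  rw [Finset.mul_sum]
  refine Finset.sum_congr rfl fun i _ => ?_
  rw [hx, hy, Real.sqrt_div hP.le, Real.sqrt_div hQ.le]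
  have h1 : Real.sqrt (m i) ≠ 0 := (Real.sqrt_pos.2 (hm i)).ne'
  have h2 : m i = Real.sqrt (m i) * Real.sqrt (m i) := (Real.mul_self_sqrt (hm i).le).symm
  generalize Real.sqrt (m i) = s at *
  rw [h2]
  field_simp

theorem com_aux {n : ℕ} (m : Fin n → ℝ) (hm : ∀ i, 0 < m i) (M P : ℝ) (hM : 0 < M)
    (hP : 0 < P) (u v x : Fin n → ℝ)
    (hx : ∀ i, x i = Real.sqrt (P / m i) * u i)
    (hv : ∀ i, v i = Real.sqrt (m i / M)) :
    ∑ i, m i * x i = Real.sqrt P * Real.sqrt M * ∑ i, u i * v i := by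
  rw [Finset.mul_sum]
  refine Finset.sum_congr rfl fun i _ => ?_
  rw [hx, hv, Real.sqrt_div hP.le, Real.sqrt_div (hm i).le]
  have h0 : Real.sqrt M ≠ 0 := (Real.sqrt_pos.2 hM).ne'
  have h1 : Real.sqrt (m i) ≠ 0 := (Real.sqrt_pos.2 (hm i)).ne'
  have h2 : m i = Real.sqrt (m i) * Real.sqrt (m i) := (Real.mul_self_sqrt (hm i).le).symm
  generalize Real.sqrt (m i) = s at *
  rw [h2]
  field_simp

/-- If `U ∈ St(n,4)` has fourth column equal to the unit mass vector
`√(mᵢ/M)`, then the coordinates recovered by unscaling the first three columns of `U`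
satisfy all nine moment/center-of-mass constraints. -/
theorem moment_constraints_of_stiefel
    (n : ℕ) (hn : 1 ≤ n)
    (m : Fin n → ℝ) (hm : ∀ i, 0 < m i)
    (M : ℝ) (hM : M = ∑ i, m i)
    (PX PY PZ : ℝ) (hPX : 0 < PX) (hPY : 0 < PY) (hPZ : 0 < PZ)
    (U : Matrix (Fin n) (Fin 4) ℝ)
    (hU : Uᵀ * U = (1 : Matrix (Fin 4) (Fin 4) ℝ))
    (hcol : ∀ i, U i 3 = Real.sqrt (m i / M))
    (x y z : Fin n → ℝ)
    (hx' : ∀ i, x i = Real.sqrt (PX / m i) * U i 0)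
    (hy' : ∀ i, y i = Real.sqrt (PY / m i) * U i 1)
    (hz' : ∀ i, z i = Real.sqrt (PZ / m i) * U i 2) :
    (∑ i, m i * x i ^ 2 = PX) ∧
    (∑ i, m i * y i ^ 2 = PY) ∧
    (∑ i, m i * z i ^ 2 = PZ) ∧
    (∑ i, m i * x i * y i = 0) ∧
    (∑ i, m i * x i * z i = 0) ∧
    (∑ i, m i * y i * z i = 0) ∧
    (∑ i, m i * x i = 0) ∧
    (∑ i, m i * y i = 0) ∧
    (∑ i, m i * z i = 0) := by
  have hMpos : 0 < M := by
    rw [hM]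
    exact Finset.sum_pos (fun i _ => hm i) ⟨⟨0, hn⟩, Finset.mem_univ _⟩
  have key : ∀ a b : Fin 4, ∑ i, U i a * U i b = (1 : Matrix (Fin 4) (Fin 4) ℝ) a b := by
    intro a b
    rw [← hU]
    simp [Matrix.mul_apply]
  have sq : ∀ (P : ℝ) (w : Fin n → ℝ) (a : Fin 4), 0 < P →
      (∀ i, w i = Real.sqrt (P / m i) * U i a) → ∑ i, m i * w i ^ 2 = P := by
    intro P w a hP hw
    have h := pair_aux m hm P P hP hP _ _ w w hw hw
    rw [key a a, Matrix.one_apply_eq, mul_one, Real.mul_self_sqrt hP.le] at h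
    rw [← h]
    exact Finset.sum_congr rfl fun i _ => by ring
  have cross : ∀ (P Q : ℝ) (w t : Fin n → ℝ) (a b : Fin 4), 0 < P → 0 < Q → a ≠ b →
      (∀ i, w i = Real.sqrt (P / m i) * U i a) → (∀ i, t i = Real.sqrt (Q / m i) * U i b) →
      ∑ i, m i * w i * t i = 0 := by
    intro P Q w t a b hP hQ hab hw ht
    rw [pair_aux m hm P Q hP hQ _ _ w t hw ht, key a b, Matrix.one_apply_ne hab, mul_zero]
  have com : ∀ (P : ℝ) (w : Fin n → ℝ) (a : Fin 4), 0 < P → a ≠ 3 →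
      (∀ i, w i = Real.sqrt (P / m i) * U i a) → ∑ i, m i * w i = 0 := by
    intro P w a hP ha hw
    rw [com_aux m hm M P hMpos hP _ (fun i => U i 3) w hw hcol, key a 3,
      Matrix.one_apply_ne ha, mul_zero]
  exact ⟨sq PX x 0 hPX hx', sq PY y 1 hPY hy', sq PZ z 2 hPZ hz',
    cross PX PY x y 0 1 hPX hPY (by decide) hx' hy',
    cross PX PZ x z 0 2 hPX hPZ (by decide) hx' hz',
    cross PY PZ y z 1 2 hPY hPZ (by decide) hy' hz',
    com PX x 0 hPX (by decide) hx', com PY y 1 hPY (by decide) hy',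
    com PZ z 2 hPZ (by decide) hz'⟩
end

section
/- (Theorem B.5, minimum-norm projection.) Let Ũ be a real n×3 matrix and a ∈ ℝⁿ such that the n×4 matrix U = [Ũ a] satisfies UᵀU = I₄. For Z ∈ ℝ^{n×3} define π(Z) = Ũ·skew(ŨᵀZ) + (I_n − UUᵀ)Z, where skew(A) = ½(A − Aᵀ). Then for every real n×3 matrix Δ satisfying ŨᵀΔ + ΔᵀŨ = 0 and aᵀΔ = 0, one has ‖Z − π(Z)‖_F ≤ ‖Z − Δ‖_F, with equality if and only if Δ = π(Z). In other words, π(Z) is the minimum-Frobenius-norm projection of Z onto the subspace {Δ ∈ ℝ^{n×3} : ŨᵀΔ skew-symmetric, aᵀΔ = 0}. -/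
open Matrix

/-- Append a fourth column `a` to an `n × 3` matrix, giving an `n × 4` matrix. -/
def appendCol {n : ℕ} (V : Matrix (Fin n) (Fin 3) ℝ) (a : Fin n → ℝ) :
    Matrix (Fin n) (Fin 4) ℝ :=
  Matrix.of fun i j => Fin.lastCases (a i) (fun k => V i k) j

/-- The skew-symmetric part of a square matrix, `skew(A) = ½(A − Aᵀ)`. -/
noncomputable def skewPart {p : ℕ} (A : Matrix (Fin p) (Fin p) ℝ) : Matrix (Fin p) (Fin p) ℝ :=
  (1 / 2 : ℝ) • (A - Aᵀ)

/-- The Frobenius norm of a real matrix, `‖A‖_F = √(trace (Aᵀ A))`. -/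
noncomputable def frobNorm {m n : Type*} [Fintype m] [Fintype n]
    (A : Matrix m n ℝ) : ℝ :=
  Real.sqrt (Matrix.trace (Aᵀ * A))

lemma frob_trace_nonneg {n : ℕ} (D : Matrix (Fin n) (Fin 3) ℝ) : 0 ≤ trace (Dᵀ * D) := by
  simp only [trace, diag, mul_apply, transpose_apply]
  exact Finset.sum_nonneg fun _ _ => Finset.sum_nonneg fun _ _ => mul_self_nonneg _

lemma frob_trace_zero {n : ℕ} (D : Matrix (Fin n) (Fin 3) ℝ) (h : trace (Dᵀ * D) = 0) :
    D = 0 := by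
  rw [← conjTranspose_eq_transpose_of_trivial] at h
  exact trace_conjTranspose_mul_self_eq_zero_iff.mp h

lemma trace_symm_skew (S K : Matrix (Fin 3) (Fin 3) ℝ) (hS : Sᵀ = S) (hK : K + Kᵀ = 0) :
    trace (S * K) = 0 := by
  have h1 : trace (S * K) = trace (Kᵀ * S) := by
    rw [← trace_transpose (S * K), transpose_mul, hS]
  have h2 : Kᵀ = -K := by rw [eq_neg_iff_add_eq_zero, add_comm]; exact hK
  rw [h2, Matrix.neg_mul, trace_neg, trace_mul_comm K S] at h1
  linarith

/-- **Theorem B.5.** `π(Z) = Ũ·skew(ŨᵀZ) + (I − UUᵀ)Z` is the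
minimum-Frobenius-norm projection of `Z` onto the tangent space of the feasible
submanifold:  for every `Δ` with `ŨᵀΔ` skew-symmetric and `aᵀΔ = 0`, we have
`‖Z − π(Z)‖_F ≤ ‖Z − Δ‖_F`, with equality iff `Δ = π(Z)`. -/
theorem projection_is_minimum_norm
    (n : ℕ) (Ut : Matrix (Fin n) (Fin 3) ℝ) (a : Fin n → ℝ)
    (U : Matrix (Fin n) (Fin 4) ℝ) (hUdef : U = appendCol Ut a)
    (hU : Uᵀ * U = (1 : Matrix (Fin 4) (Fin 4) ℝ))
    (Z : Matrix (Fin n) (Fin 3) ℝ)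
    (π : Matrix (Fin n) (Fin 3) ℝ)
    (hπ : π = Ut * skewPart (Utᵀ * Z) + ((1 : Matrix (Fin n) (Fin n) ℝ) - U * Uᵀ) * Z) :
    ∀ Δ : Matrix (Fin n) (Fin 3) ℝ,
      Utᵀ * Δ + Δᵀ * Ut = 0 → (∀ j, ∑ i, a i * Δ i j = 0) →
        frobNorm (Z - π) ≤ frobNorm (Z - Δ) ∧
        (frobNorm (Z - π) = frobNorm (Z - Δ) ↔ Δ = π) := by
  intro Δ hΔ haΔ
  obtain ⟨A, hA⟩ : ∃ A : Matrix (Fin n) (Fin 1) ℝ, A = Matrix.of fun i _ => a i := ⟨_, rfl⟩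
  have hent : ∀ p q : Fin 4, ∑ i, U i p * U i q = (1 : Matrix (Fin 4) (Fin 4) ℝ) p q := by
    intro p q
    rw [← hU]; simp [mul_apply]
  have hUc : ∀ i (k : Fin 3), U i k.castSucc = Ut i k := by
    intro i k; rw [hUdef]; simp only [appendCol, of_apply, Fin.lastCases_castSucc]
  have hUl : ∀ i, U i (Fin.last 3) = a i := by
    intro i; rw [hUdef]; simp only [appendCol, of_apply, Fin.lastCases_last]
  have h1 : Utᵀ * Ut = 1 := by
    ext p q
    have := hent p.castSucc q.castSucc
    simp only [hUc] at this
    simp only [mul_apply, transpose_apply, this, one_apply, Fin.castSucc_inj]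
  have h2 : Aᵀ * Ut = 0 := by
    ext p q
    have := hent (Fin.last 3) q.castSucc
    simp only [hUc, hUl] at this
    rw [one_apply_ne (Fin.castSucc_lt_last q).ne'] at this
    simpa [mul_apply, hA] using this
  have h2' : Utᵀ * A = 0 := by
    have := congrArg transpose h2
    simpa using this
  have h3 : Aᵀ * A = 1 := by
    ext p q
    have := hent (Fin.last 3) (Fin.last 3)
    simp only [hUl, one_apply_eq] at this
    simp only [mul_apply, transpose_apply, hA, of_apply, this, one_apply, Subsingleton.elim p q,
      if_true]
  have h4 : U * Uᵀ = Ut * Utᵀ + A * Aᵀ := by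
    ext i j
    simp only [mul_apply, Matrix.add_apply, transpose_apply]
    rw [Fin.sum_univ_castSucc]
    simp only [hUc, hUl]
    simp [hA]
  have h5 : Aᵀ * Δ = 0 := by
    ext p q
    simpa [mul_apply, hA] using haΔ q
  obtain ⟨W, hW⟩ : ∃ W, W = Utᵀ * Z := ⟨_, rfl⟩
  have hπ2 : π = Ut * skewPart W + (Z - Ut * W - A * (Aᵀ * Z)) := by
    rw [hπ, h4, hW, Matrix.sub_mul, Matrix.add_mul, Matrix.one_mul, Matrix.mul_assoc,
      Matrix.mul_assoc]
    abel
  have h6 : Utᵀ * π = skewPart W := by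
    rw [hπ2, Matrix.mul_add, Matrix.mul_sub, Matrix.mul_sub, ← Matrix.mul_assoc,
      ← Matrix.mul_assoc Utᵀ Ut W, ← Matrix.mul_assoc Utᵀ A, h1, h2', ← hW]
    simp
  have h7 : Aᵀ * π = 0 := by
    rw [hπ2, Matrix.mul_add, Matrix.mul_sub, Matrix.mul_sub, ← Matrix.mul_assoc,
      ← Matrix.mul_assoc Aᵀ Ut W, ← Matrix.mul_assoc Aᵀ A, h2, h3]
    simp
  obtain ⟨S, hS⟩ : ∃ S, S = W - skewPart W := ⟨_, rfl⟩
  have hSs : Sᵀ = S := by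
    rw [hS]; ext i j; simp [skewPart]; ring
  have hR : Z - π = Ut * S + A * (Aᵀ * Z) := by
    rw [hπ2, hS, Matrix.mul_sub]; abel
  obtain ⟨D, hD⟩ : ∃ D, D = π - Δ := ⟨_, rfl⟩
  have hAD : Aᵀ * D = 0 := by rw [hD, Matrix.mul_sub, h7, h5, sub_zero]
  have hK : Utᵀ * D + (Utᵀ * D)ᵀ = 0 := by
    have e : (Utᵀ * Δ)ᵀ = Δᵀ * Ut := by simp
    have e2 : skewPart W + (skewPart W)ᵀ = 0 := by
      ext i j; simp [skewPart]; ring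
    rw [hD, Matrix.mul_sub, h6, transpose_sub, e]
    calc _ = (skewPart W + (skewPart W)ᵀ) - (Utᵀ * Δ + Δᵀ * Ut) := by abel
      _ = 0 := by rw [e2, hΔ, sub_zero]
  have horth : trace ((Z - π)ᵀ * D) = 0 := by
    rw [hR, transpose_add, transpose_mul, transpose_mul A, Matrix.add_mul, Matrix.mul_assoc,
      Matrix.mul_assoc _ Aᵀ D, hAD, hSs, Matrix.mul_zero, add_zero]
    exact trace_symm_skew _ _ hSs hK
  have horth' : trace (Dᵀ * (Z - π)) = 0 := by
    rw [← horth, ← trace_transpose (Dᵀ * (Z - π)), transpose_mul, transpose_transpose]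
  have hpyth : trace ((Z - Δ)ᵀ * (Z - Δ)) = trace ((Z - π)ᵀ * (Z - π)) + trace (Dᵀ * D) := by
    have e : Z - Δ = (Z - π) + D := by rw [hD]; abel
    rw [e, transpose_add, Matrix.add_mul, Matrix.mul_add, Matrix.mul_add, trace_add, trace_add,
      trace_add, horth, horth']
    ring
  have hn := frob_trace_nonneg D
  unfold frobNorm
  refine ⟨Real.sqrt_le_sqrt (by linarith), fun h => ?_, fun h => by rw [h]⟩
  rw [Real.sqrt_inj (frob_trace_nonneg _) (frob_trace_nonneg _)] at h
  have := frob_trace_zero D (by linarith)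
  rw [hD, sub_eq_zero] at this
  exact this.symm
end
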